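/- Let B be a nondegenerate alternating bilinear form on F_q^{2n} with n ≥ 2, let X and Y be points, let i ∈ {1,…,n} and j ∈ {n+1,…,2n}. Then |C_i^X ∩ C_j^Y| equals: 0 if X = Y; if X ≠ Y and X ⊆ Y^⊥ (X and Y collinear): c(n−2,1)·q^{i+j−3} when i+j < 2n+1, 0 when i+j = 2n+1, and c(n−2,1)·q^{i+j−4} when i+j > 2n+1; if X ⊄ Y^⊥ (X and Y opposite): 0 when i+j < 2n+1, c(n−1,1) when i+j = 2n+1, and c(n−1,1)·(q−1)·q^{i+j−2n−2} when i+j > 2n+1. -/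

import Mathlib

open Matrix

/-- A maximal isotropic flag for the bilinear form `B` on `F^(2n)`: a chain
`U 0 ⊆ U 1 ⊆ ⋯ ⊆ U n` with `dim (U k) = k` (so `U 0 = ⊥`) whose top member (and hence
every member) is totally isotropic. -/
def SympFlag (F : Type) [Field F] (n : ℕ) (B : LinearMap.BilinForm F (Fin (2 * n) → F)) :
    Type :=
  {U : Fin (n + 1) → Submodule F (Fin (2 * n) → F) //
    Monotone U ∧ (∀ k : Fin (n + 1), Module.finrank F (U k) = (k : ℕ)) ∧
    ∀ x ∈ U (Fin.last n), ∀ y ∈ U (Fin.last n), B x y = 0}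

/-- The `k`-th member (for `k : ℕ`, `1`-based) of the chain
`U_1 ⊆ ⋯ ⊆ U_n ⊆ U_(n-1)^⊥ ⊆ ⋯ ⊆ U_1^⊥`; equal to `⊤` for `k ≥ 2n`. -/
noncomputable def sympMem {F : Type} [Field F] {n : ℕ}
    {B : LinearMap.BilinForm F (Fin (2 * n) → F)} (c : SympFlag F n B) (k : ℕ) :
    Submodule F (Fin (2 * n) → F) :=
  if h : k ≤ n then c.1 ⟨k, by omega⟩
  else if h2 : k ≤ 2 * n - 1 then B.orthogonal (c.1 ⟨2 * n - k, by omega⟩)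
  else ⊤

/-- The type of a maximal isotropic flag with respect to a point `X`: the smallest `k`
such that `X` is contained in the `k`-th member of the chain
`U_1 ⊆ ⋯ ⊆ U_n ⊆ U_(n-1)^⊥ ⊆ ⋯ ⊆ U_1^⊥`, and `2n` if `X ⊄ U_1^⊥`. -/
noncomputable def sympType {F : Type} [Field F] {n : ℕ}
    {B : LinearMap.BilinForm F (Fin (2 * n) → F)} (c : SympFlag F n B)
    (X : Submodule F (Fin (2 * n) → F)) : ℕ :=
  sInf {k : ℕ | X ≤ sympMem c k}

/-- `c(k,1) = ∏_{i=1}^{k} (q^(2i)-1)/(q-1)`. -/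
noncomputable def cB (q : ℚ) (k : ℕ) : ℚ :=
  ∏ i ∈ Finset.Icc 1 k, (q ^ (2 * i) - 1) / (q - 1)

/-- Chains `U 0, …, U n` with `U k` in level `k` and consecutive members related by `r`. -/
def LevelChain {S : Type*} (Q : ℕ → S → Prop) (r : S → S → Prop) (n : ℕ) : Type _ :=
  {U : Fin (n + 1) → S // (∀ k : Fin (n + 1), Q k (U k)) ∧ ∀ k : Fin n, r (U k.castSucc) (U k.succ)}

/-- A chain with one more member is a chain followed by a successor of its last member. -/
def levelChainSuccEquiv {S : Type*} (Q : ℕ → S → Prop) (r : S → S → Prop) (n : ℕ) :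
    LevelChain Q r (n + 1) ≃
      (Σ p : LevelChain Q r n, {s : S // Q (n + 1) s ∧ r (p.1 (Fin.last n)) s}) where
  toFun U := ⟨⟨fun k => U.1 k.castSucc, fun k => by simpa using U.2.1 k.castSucc,
      fun k => by simpa using U.2.2 k.castSucc⟩,
    ⟨U.1 (Fin.last _), by simpa using U.2.1 (Fin.last _), by simpa using U.2.2 (Fin.last n)⟩⟩
  invFun p := ⟨Fin.snoc (α := fun _ => S) p.1.1 p.2.1, by
      intro k
      induction k using Fin.lastCases with
      | last => simpa using p.2.2.1
      | cast k => simpa using p.1.2.1 k, by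
      intro k
      induction k using Fin.lastCases with
      | last => simpa [← Fin.castSucc_succ] using p.2.2.2
      | cast k => simpa only [Fin.succ_castSucc, Fin.snoc_castSucc] using p.1.2.2 k⟩
  left_inv U := by
    apply Subtype.ext
    funext k
    induction k using Fin.lastCases <;> simp
  right_inv p := by
    obtain ⟨⟨U, hU⟩, ⟨s, hs⟩⟩ := p
    refine Sigma.ext (Subtype.ext (funext fun k => Fin.snoc_castSucc (α := fun _ => S) _ _ _)) ?_
    refine (Subtype.heq_iff_coe_eq fun t => ?_).2 (Fin.snoc_last (α := fun _ => S) _ _)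
    simp only [Fin.snoc_castSucc]

/-- If the number of successors of a member of level `k` is always `G k / G (k + 1)`, then the
number of chains of length `n` is `G 0 / G n`. -/
theorem card_levelChain {S : Type*} [Finite S] (Q : ℕ → S → Prop) (r : S → S → Prop) (G : ℕ → ℚ)
    (s₀ : S) (h₀ : ∀ s, Q 0 s ↔ s = s₀) (n : ℕ)
    (hstep : ∀ k < n, ∀ s, Q k s → ({t | Q (k + 1) t ∧ r s t}.ncard : ℚ) * G (k + 1) = G k) :
    (Nat.card (LevelChain Q r n) : ℚ) * G n = G 0 := by
  induction n with
  | zero =>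
    have : Nat.card (LevelChain Q r 0) = 1 := by
      rw [Nat.card_eq_one_iff_unique]
      refine ⟨⟨fun U U' => Subtype.ext (funext fun k => ?_)⟩,
        ⟨⟨fun _ => s₀, fun k => ?_, fun k => k.elim0⟩⟩⟩
      · obtain rfl : k = 0 := Fin.fin_one_eq_zero k
        rw [(h₀ _).1 (U.2.1 0), (h₀ _).1 (U'.2.1 0)]
      · obtain rfl : k = 0 := Fin.fin_one_eq_zero k
        exact (h₀ _).2 rfl
    simp [this]
  | succ n ih =>
    have : Finite (LevelChain Q r n) := Subtype.finite
    have : Fintype (LevelChain Q r n) := Fintype.ofFinite _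
    rw [Nat.card_congr (levelChainSuccEquiv Q r n), Nat.card_sigma, Nat.cast_sum, Finset.sum_mul,
      ← ih fun k hk => hstep k (by omega), Nat.card_eq_fintype_card, ← nsmul_eq_mul,
      ← Finset.card_univ, ← Finset.sum_const]
    refine Finset.sum_congr rfl fun p _ => ?_
    exact hstep n (by omega) _ (p.2.1 (Fin.last n))

section Subspaces

variable {F V : Type*} [Field F] [AddCommGroup V] [Module F V]

theorem mem_sup_span_self (W : Submodule F V) (u : V) : u ∈ W ⊔ F ∙ u :=
  Submodule.mem_sup_right (Submodule.mem_span_singleton_self u)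

/-- Steinitz exchange for a subspace and two vectors. -/
theorem mem_sup_span_exchange {W : Submodule F V} {u v : V} (h : u ∈ W ⊔ F ∙ v) (hu : u ∉ W) :
    v ∈ W ⊔ F ∙ u := by
  obtain ⟨w, hw, z, hz, rfl⟩ := Submodule.mem_sup.1 h
  obtain ⟨a, rfl⟩ := Submodule.mem_span_singleton.1 hz
  have ha : a ≠ 0 := by
    rintro rfl
    exact hu (by simpa using hw)
  generalize hu' : w + a • v = u
  have : v = -(a⁻¹ • w) + a⁻¹ • u := by
    rw [← hu', smul_add, smul_smul, inv_mul_cancel₀ ha, one_smul]; abel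
  rw [this]
  exact add_mem (Submodule.mem_sup_left (neg_mem (W.smul_mem _ hw)))
    (Submodule.smul_mem _ _ (mem_sup_span_self W u))

theorem mem_sup_span_comm {W : Submodule F V} {u v z : V} :
    z ∈ W ⊔ F ∙ u ⊔ F ∙ v ↔ z ∈ W ⊔ F ∙ v ⊔ F ∙ u := by
  rw [sup_right_comm]

variable [Module.Finite F V]

theorem sup_span_eq_of_finrank {W W' : Submodule F V} {u : V} (h : W ≤ W')
    (hd : Module.finrank F W' = Module.finrank F W + 1) (hu : u ∈ W') (hu' : u ∉ W) :
    W ⊔ F ∙ u = W' := by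
  refine Submodule.eq_of_le_of_finrank_eq (sup_le h (by simpa using hu)) ?_
  rw [Submodule.finrank_sup_span_singleton hu', hd]

variable [Fintype F]

theorem ncard_submodule (W : Submodule F V) :
    (W : Set V).ncard = Fintype.card F ^ Module.finrank F W := by
  rw [← Nat.card_coe_set_eq, ← Nat.card_eq_fintype_card]
  exact Module.natCard_eq_pow_finrank (K := F) (V := W)

theorem ncard_submodule_diff {W W' : Submodule F V} (h : W ≤ W') :
    (((W' : Set V) \ W).ncard : ℚ) =
      (Fintype.card F : ℚ) ^ Module.finrank F W' - (Fintype.card F : ℚ) ^ Module.finrank F W := by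
  have : Finite V := Module.finite_of_finite F
  have := Set.ncard_sdiff_add_ncard_of_subset (s := (W : Set V)) (t := W') h
  rw [ncard_submodule, ncard_submodule] at this
  rw [eq_sub_iff_add_eq]
  exact_mod_cast this

/-- Counting the one-dimensional extensions of `W` with a property through their generators. -/
theorem ncard_extensions_mul (W : Submodule F V) (C : Submodule F V → Prop) (k : ℕ)
    (hW : Module.finrank F W = k) (hC : ∀ W', C W' → Module.finrank F W' = k + 1) :
    ({W' | C W' ∧ W ≤ W'}.ncard : ℚ) *
        ((Fintype.card F : ℚ) ^ (k + 1) - (Fintype.card F : ℚ) ^ k) =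
      {u | u ∉ W ∧ C (W ⊔ F ∙ u)}.ncard := by
  classical
  have : Finite V := Module.finite_of_finite F
  have : Fintype V := Fintype.ofFinite V
  have : Finite (Submodule F V) := Finite.of_injective _ SetLike.coe_injective
  have : Fintype (Submodule F V) := Fintype.ofFinite _
  rw [Set.ncard_eq_toFinset_card', Set.ncard_eq_toFinset_card' {u | u ∉ W ∧ C (W ⊔ F ∙ u)},
    Finset.card_eq_sum_card_fiberwise (f := fun u => W ⊔ F ∙ u)
      (t := {W' | C W' ∧ W ≤ W'}.toFinset), Nat.cast_sum, ← nsmul_eq_mul, ← Finset.sum_const]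
  · refine Finset.sum_congr rfl fun W' hW' => ?_
    simp only [Set.mem_toFinset, Set.mem_ofPred_eq] at hW'
    have hd := hC W' hW'.1
    rw [← hd, ← hW, ← ncard_submodule_diff hW'.2, Set.ncard_eq_toFinset_card']
    congr 2
    ext u
    simp only [Set.mem_toFinset, Set.mem_sdiff, SetLike.mem_coe, Finset.mem_filter,
      Set.mem_ofPred_eq]
    constructor
    · rintro ⟨h1, h2⟩
      have := sup_span_eq_of_finrank hW'.2 (by omega) h1 h2
      exact ⟨⟨h2, this ▸ hW'.1⟩, this⟩
    · rintro ⟨⟨h1, h2⟩, rfl⟩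
      exact ⟨mem_sup_span_self _ _, h1⟩
  · intro u hu
    simp only [Set.coe_toFinset, Set.mem_ofPred_eq] at hu ⊢
    exact ⟨hu.2, le_sup_left⟩

end Subspaces

section Symplectic

variable {F V : Type*} [Field F] [AddCommGroup V] [Module F V] {B : LinearMap.BilinForm F V}
  {x y u : V} {i m k n : ℕ} {W : Submodule F V}

theorem mem_orthogonal_sup_span {v : V} :
    v ∈ B.orthogonal (W ⊔ F ∙ u) ↔ v ∈ B.orthogonal W ∧ B u v = 0 := by
  constructor
  · exact fun h => ⟨LinearMap.BilinForm.orthogonal_le le_sup_left h, h u (mem_sup_span_self W u)⟩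
  · rintro ⟨h1, h2⟩ z hz
    obtain ⟨w, hw, z', hz', rfl⟩ := Submodule.mem_sup.1 hz
    obtain ⟨a, rfl⟩ := Submodule.mem_span_singleton.1 hz'
    have h3 : B w v = 0 := h1 w hw
    change B (w + a • u) v = 0
    rw [map_add, LinearMap.add_apply, map_smul, LinearMap.smul_apply, h3, h2, smul_zero, add_zero]

/-- The conditions on the `k`-th member `W` of a maximal isotropic flag expressing that the point
spanned by `x` lies in exactly the members of index at least `i`, and that the point spanned by `y`
is orthogonal to exactly the members of index less than `m`. -/
structure IsLevel (B : LinearMap.BilinForm F V) (x y : V) (i m k : ℕ) (W : Submodule F V) :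
    Prop where
  finrank_eq : Module.finrank F W = k
  isotropic : W ≤ B.orthogonal W
  mem_orthogonal : x ∈ B.orthogonal W
  mem_iff : x ∈ W ↔ i ≤ k
  mem_orthogonal_iff : y ∈ B.orthogonal W ↔ k < m
  notMem_sup : y ∉ W ⊔ F ∙ x

theorem isotropic_of_sup_span (h : W ⊔ F ∙ u ≤ B.orthogonal (W ⊔ F ∙ u)) :
    u ∈ B.orthogonal W :=
  (mem_orthogonal_sup_span.1 (h (mem_sup_span_self W u))).1

theorem notMem_sup_of_notMem_orthogonal (hW : W ≤ B.orthogonal W) (hx : x ∈ B.orthogonal W)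
    (hy : y ∉ B.orthogonal W) : y ∉ W ⊔ F ∙ x :=
  fun h => hy (sup_le hW (by simpa using hx) h)

theorem IsLevel.notMem_of_lt (h : IsLevel B x y i m k W) (hi : k < i) : x ∉ W := fun hx => by
  have := h.mem_iff.1 hx
  omega

section Alternating

variable (hB : B.IsAlt)
include hB

theorem isotropic_sup_span (hW : W ≤ B.orthogonal W) (hu : u ∈ B.orthogonal W) :
    W ⊔ F ∙ u ≤ B.orthogonal (W ⊔ F ∙ u) := by
  refine sup_le (fun w hw => ?_) ?_
  · exact mem_orthogonal_sup_span.2 ⟨hW hw, hB.isRefl _ _ (hu w hw)⟩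
  · simpa using mem_orthogonal_sup_span.2 ⟨hu, hB u⟩

namespace IsLevel

variable (h : IsLevel B x y i m k W)
include h

theorem isotropic_sup : W ⊔ F ∙ x ≤ B.orthogonal (W ⊔ F ∙ x) :=
  isotropic_sup_span hB h.isotropic h.mem_orthogonal

/-- Extending a level past the last index at which `y` is orthogonal. -/
theorem extend_iff_of_le [Module.Finite F V] (hm : m ≤ k + 1) (hu : u ∉ W) :
    IsLevel B x y i m (k + 1) (W ⊔ F ∙ u) ↔
      u ∈ B.orthogonal W ∧ B u x = 0 ∧ (x ∈ W ⊔ F ∙ u ↔ i ≤ k + 1) ∧ (k + 1 = m → B u y ≠ 0) := by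
  constructor
  · intro h'
    refine ⟨isotropic_of_sup_span h'.isotropic, (mem_orthogonal_sup_span.1 h'.mem_orthogonal).2,
      h'.mem_iff, fun hk hy => ?_⟩
    have := h'.mem_orthogonal_iff.1 (mem_orthogonal_sup_span.2 ⟨h.mem_orthogonal_iff.2 (by omega), hy⟩)
    omega
  · rintro ⟨h1, h2, h3, h4⟩
    have h5 : y ∉ B.orthogonal (W ⊔ F ∙ u) := fun hy => by
      rw [mem_orthogonal_sup_span, h.mem_orthogonal_iff] at hy
      exact h4 (by omega) hy.2
    have h6 := isotropic_sup_span hB h.isotropic h1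
    have h7 := mem_orthogonal_sup_span.2 ⟨h.mem_orthogonal, h2⟩
    refine ⟨?_, h6, h7, h3, iff_of_false h5 (by omega), notMem_sup_of_notMem_orthogonal h6 h7 h5⟩
    rw [Submodule.finrank_sup_span_singleton hu, h.finrank_eq]

/-- Extending a level before the last index at which `y` is orthogonal. -/
theorem extend_iff_of_lt [Module.Finite F V] (hm : k + 1 < m) (hu : u ∉ W) :
    IsLevel B x y i m (k + 1) (W ⊔ F ∙ u) ↔
      u ∈ B.orthogonal W ∧ B u x = 0 ∧ (x ∈ W ⊔ F ∙ u ↔ i ≤ k + 1) ∧ B u y = 0 ∧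
        y ∉ W ⊔ F ∙ u ⊔ F ∙ x := by
  constructor
  · intro h'
    exact ⟨isotropic_of_sup_span h'.isotropic,
      (mem_orthogonal_sup_span.1 h'.mem_orthogonal).2, h'.mem_iff,
      (mem_orthogonal_sup_span.1 (h'.mem_orthogonal_iff.2 hm)).2, h'.notMem_sup⟩
  · rintro ⟨h1, h2, h3, h4, h5⟩
    refine ⟨?_, isotropic_sup_span hB h.isotropic h1,
      mem_orthogonal_sup_span.2 ⟨h.mem_orthogonal, h2⟩, h3, iff_of_true ?_ hm, h5⟩
    · rw [Submodule.finrank_sup_span_singleton hu, h.finrank_eq]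
    · exact mem_orthogonal_sup_span.2 ⟨h.mem_orthogonal_iff.2 (by omega), h4⟩

variable [Module.Finite F V]

theorem setOf_extend_of_le_of_le (hi : i ≤ k) (hm : m ≤ k) :
    {u | u ∉ W ∧ IsLevel B x y i m (k + 1) (W ⊔ F ∙ u)} = (B.orthogonal W : Set V) \ W := by
  have hx := h.mem_iff.2 hi
  ext u
  simp only [Set.mem_ofPred_eq, Set.mem_sdiff, SetLike.mem_coe]
  constructor
  · rintro ⟨h1, h2⟩
    exact ⟨((h.extend_iff_of_le hB (by omega) h1).1 h2).1, h1⟩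
  · rintro ⟨h1, h2⟩
    exact ⟨h2, (h.extend_iff_of_le hB (by omega) h2).2 ⟨h1, hB.isRefl _ _ (h1 x hx),
      iff_of_true (Submodule.mem_sup_left hx) (by omega), by omega⟩⟩

theorem setOf_extend_of_le_of_eq (hi : i ≤ k) (hm : k + 1 = m) :
    {u | u ∉ W ∧ IsLevel B x y i m (k + 1) (W ⊔ F ∙ u)} =
      (B.orthogonal W : Set V) \ B.orthogonal (W ⊔ F ∙ y) := by
  have hx := h.mem_iff.2 hi
  have hy := h.mem_orthogonal_iff.2 (by omega)
  ext u
  simp only [Set.mem_ofPred_eq, Set.mem_sdiff, SetLike.mem_coe]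
  rw [mem_orthogonal_sup_span]
  constructor
  · rintro ⟨h1, h2⟩
    obtain ⟨h3, -, -, h4⟩ := (h.extend_iff_of_le hB (by omega) h1).1 h2
    exact ⟨h3, fun h5 => h4 hm (hB.isRefl _ _ h5.2)⟩
  · rintro ⟨h1, h2⟩
    have h3 : u ∉ W := fun hu => h2 ⟨h1, hB.isRefl _ _ (hy u hu)⟩
    exact ⟨h3, (h.extend_iff_of_le hB (by omega) h3).2 ⟨h1, hB.isRefl _ _ (h1 x hx),
      iff_of_true (Submodule.mem_sup_left hx) (by omega),
      fun _ h4 => h2 ⟨h1, hB.isRefl _ _ h4⟩⟩⟩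

theorem setOf_extend_of_le_of_lt (hi : i ≤ k) (hm : k + 1 < m) :
    {u | u ∉ W ∧ IsLevel B x y i m (k + 1) (W ⊔ F ∙ u)} =
      (B.orthogonal (W ⊔ F ∙ y) : Set V) \ (W ⊔ F ∙ y : Submodule F V) := by
  have hx := h.mem_iff.2 hi
  have hyW : y ∉ W := fun hy => h.notMem_sup (Submodule.mem_sup_left hy)
  ext u
  simp only [Set.mem_ofPred_eq, Set.mem_sdiff, SetLike.mem_coe]
  rw [mem_orthogonal_sup_span]
  have hsup : W ⊔ F ∙ u ⊔ F ∙ x = W ⊔ F ∙ u :=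
    sup_eq_left.2 (by simpa using Submodule.mem_sup_left hx)
  constructor
  · rintro ⟨h1, h2⟩
    obtain ⟨h3, -, -, h4, h5⟩ := (h.extend_iff_of_lt hB hm h1).1 h2
    exact ⟨⟨h3, hB.isRefl _ _ h4⟩, fun h6 => h5 (hsup.symm ▸ mem_sup_span_exchange h6 h1)⟩
  · rintro ⟨⟨h1, h2⟩, h3⟩
    have h4 : u ∉ W := fun hu => h3 (Submodule.mem_sup_left hu)
    exact ⟨h4, (h.extend_iff_of_lt hB hm h4).2 ⟨h1, hB.isRefl _ _ (h1 x hx),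
      iff_of_true (Submodule.mem_sup_left hx) (by omega), hB.isRefl _ _ h2,
      fun h5 => h3 (mem_sup_span_exchange (hsup ▸ h5) hyW)⟩⟩

theorem setOf_extend_of_eq (hi : k + 1 = i) (hm : k + 1 = m → B x y ≠ 0)
    (hm' : k + 1 < m → B x y = 0) :
    {u | u ∉ W ∧ IsLevel B x y i m (k + 1) (W ⊔ F ∙ u)} =
      ((W ⊔ F ∙ x : Submodule F V) : Set V) \ W := by
  have hx := h.notMem_of_lt (by omega)
  ext u
  simp only [Set.mem_ofPred_eq, Set.mem_sdiff, SetLike.mem_coe]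
  constructor
  · rintro ⟨h1, h2⟩
    exact ⟨mem_sup_span_exchange (h2.mem_iff.2 (by omega)) hx, h1⟩
  · rintro ⟨h1, h2⟩
    refine ⟨h2, ?_⟩
    have h3 := mem_orthogonal_sup_span.1 (h.isotropic_sup hB h1)
    have h4 := mem_sup_span_exchange h1 h2
    rcases lt_or_ge (k + 1) m with hk | hk
    · refine (h.extend_iff_of_lt hB hk h2).2
        ⟨h3.1, hB.isRefl _ _ h3.2, iff_of_true h4 (by omega), ?_, ?_⟩
      · have : y ∈ B.orthogonal (W ⊔ F ∙ x) :=
          mem_orthogonal_sup_span.2 ⟨h.mem_orthogonal_iff.2 (by omega), hm' hk⟩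
        exact this u h1
      · rw [sup_right_comm, sup_eq_left.2 ((Submodule.span_singleton_le_iff_mem _ _).2 h1)]
        exact h.notMem_sup
    · refine (h.extend_iff_of_le hB hk h2).2
        ⟨h3.1, hB.isRefl _ _ h3.2, iff_of_true h4 (by omega), fun hk' hy => ?_⟩
      have : y ∈ B.orthogonal (W ⊔ F ∙ u) :=
        mem_orthogonal_sup_span.2 ⟨h.mem_orthogonal_iff.2 (by omega), hy⟩
      exact hm hk' (this x h4)

theorem setOf_extend_of_lt_of_le (hi : k + 1 < i) (hm : m ≤ k) :
    {u | u ∉ W ∧ IsLevel B x y i m (k + 1) (W ⊔ F ∙ u)} =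
      (B.orthogonal (W ⊔ F ∙ x) : Set V) \ (W ⊔ F ∙ x : Submodule F V) := by
  have hx := h.notMem_of_lt (by omega)
  ext u
  simp only [Set.mem_ofPred_eq, Set.mem_sdiff, SetLike.mem_coe]
  rw [mem_orthogonal_sup_span]
  constructor
  · rintro ⟨h1, h2⟩
    obtain ⟨h3, h4, h5, -⟩ := (h.extend_iff_of_le hB (by omega) h1).1 h2
    refine ⟨⟨h3, hB.isRefl _ _ h4⟩, fun h6 => ?_⟩
    have := h5.1 (mem_sup_span_exchange h6 h1)
    omega
  · rintro ⟨⟨h1, h2⟩, h3⟩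
    have h4 : u ∉ W := fun hu => h3 (Submodule.mem_sup_left hu)
    exact ⟨h4, (h.extend_iff_of_le hB (by omega) h4).2 ⟨h1, hB.isRefl _ _ h2,
      iff_of_false (fun h5 => h3 (mem_sup_span_exchange h5 hx)) (by omega), by omega⟩⟩

theorem setOf_extend_of_lt_of_eq (hi : k + 1 < i) (hm : k + 1 = m) :
    {u | u ∉ W ∧ IsLevel B x y i m (k + 1) (W ⊔ F ∙ u)} =
      ((B.orthogonal (W ⊔ F ∙ x) : Set V) \ B.orthogonal (W ⊔ F ∙ x ⊔ F ∙ y)) \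
        (W ⊔ F ∙ x : Submodule F V) := by
  have hx := h.notMem_of_lt (by omega)
  ext u
  simp only [Set.mem_ofPred_eq, Set.mem_sdiff, SetLike.mem_coe]
  rw [mem_orthogonal_sup_span (u := y), mem_orthogonal_sup_span]
  constructor
  · rintro ⟨h1, h2⟩
    obtain ⟨h3, h4, h5, h6⟩ := (h.extend_iff_of_le hB (by omega) h1).1 h2
    refine ⟨⟨⟨h3, hB.isRefl _ _ h4⟩, fun h7 => h6 hm (hB.isRefl _ _ h7.2)⟩, fun h7 => ?_⟩
    have := h5.1 (mem_sup_span_exchange h7 h1)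
    omega
  · rintro ⟨⟨⟨h1, h2⟩, h5⟩, h3⟩
    have h4 : u ∉ W := fun hu => h3 (Submodule.mem_sup_left hu)
    exact ⟨h4, (h.extend_iff_of_le hB (by omega) h4).2 ⟨h1, hB.isRefl _ _ h2,
      iff_of_false (fun h6 => h3 (mem_sup_span_exchange h6 hx)) (by omega),
      fun _ h6 => h5 ⟨⟨h1, h2⟩, hB.isRefl _ _ h6⟩⟩⟩

theorem setOf_extend_of_lt_of_lt (hi : k + 1 < i) (hm : k + 1 < m) :
    {u | u ∉ W ∧ IsLevel B x y i m (k + 1) (W ⊔ F ∙ u)} =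
      (B.orthogonal (W ⊔ F ∙ x ⊔ F ∙ y) : Set V) \ (W ⊔ F ∙ x ⊔ F ∙ y : Submodule F V) := by
  have hx := h.notMem_of_lt (by omega)
  ext u
  simp only [Set.mem_ofPred_eq, Set.mem_sdiff, SetLike.mem_coe]
  rw [mem_orthogonal_sup_span, mem_orthogonal_sup_span]
  constructor
  · rintro ⟨h1, h2⟩
    obtain ⟨h3, h4, h5, h6, h7⟩ := (h.extend_iff_of_lt hB hm h1).1 h2
    refine ⟨⟨⟨h3, hB.isRefl _ _ h4⟩, hB.isRefl _ _ h6⟩, fun h8 => ?_⟩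
    refine h7 (mem_sup_span_comm.1 (mem_sup_span_exchange h8 fun h9 => ?_))
    have := h5.1 (mem_sup_span_exchange h9 h1)
    omega
  · rintro ⟨⟨⟨h1, h2⟩, h5⟩, h3⟩
    have h4 : u ∉ W ⊔ F ∙ x := fun hu => h3 (Submodule.mem_sup_left hu)
    have h4' : u ∉ W := fun hu => h4 (Submodule.mem_sup_left hu)
    exact ⟨h4', (h.extend_iff_of_lt hB hm h4').2 ⟨h1, hB.isRefl _ _ h2,
      iff_of_false (fun h6 => h4 (mem_sup_span_exchange h6 hx)) (by omega), hB.isRefl _ _ h5,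
      fun h6 => h3 (mem_sup_span_exchange (mem_sup_span_comm.1 h6) h.notMem_sup)⟩⟩

end IsLevel

end Alternating

section Counting

variable [Fintype F] in
/-- The number of members of level `k + 1` containing `W`, times the number of vectors of each that
lie outside `W` when `W` has dimension `k`. -/
noncomputable def extensionGenerators (B : LinearMap.BilinForm F V) (x y : V) (i m k : ℕ)
    (W : Submodule F V) : ℚ :=
  {W' | IsLevel B x y i m (k + 1) W' ∧ W ≤ W'}.ncard *
    ((Fintype.card F : ℚ) ^ (k + 1) - (Fintype.card F : ℚ) ^ k)

variable [Module.Finite F V] (hB : B.IsAlt) (hnd : B.Nondegenerate)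
  (hV : Module.finrank F V = 2 * n)

namespace IsLevel

variable (h : IsLevel B x y i m k W)

include h

theorem finrank_sup (hi : k < i) : Module.finrank F (W ⊔ F ∙ x : Submodule F V) = k + 1 := by
  rw [Submodule.finrank_sup_span_singleton (h.notMem_of_lt hi), h.finrank_eq]

theorem finrank_sup_right : Module.finrank F (W ⊔ F ∙ y : Submodule F V) = k + 1 := by
  rw [Submodule.finrank_sup_span_singleton fun hy => h.notMem_sup (Submodule.mem_sup_left hy),
    h.finrank_eq]

theorem finrank_sup_sup (hi : k < i) :
    Module.finrank F (W ⊔ F ∙ x ⊔ F ∙ y : Submodule F V) = k + 2 := by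
  rw [Submodule.finrank_sup_span_singleton h.notMem_sup, h.finrank_sup hi]

variable [Fintype F]

theorem extensionGenerators_eq :
    extensionGenerators B x y i m k W =
      {u | u ∉ W ∧ IsLevel B x y i m (k + 1) (W ⊔ F ∙ u)}.ncard :=
  ncard_extensions_mul W _ k h.finrank_eq fun _ h' => h'.finrank_eq

include hB

theorem extensionGenerators_of_eq (hi : k + 1 = i) (hm : k + 1 = m → B x y ≠ 0)
    (hm' : k + 1 < m → B x y = 0) :
    extensionGenerators B x y i m k W =
      (Fintype.card F : ℚ) ^ (k + 1) - (Fintype.card F : ℚ) ^ k := by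
  rw [h.extensionGenerators_eq, h.setOf_extend_of_eq hB hi hm hm',
    ncard_submodule_diff (le_sup_left : W ≤ W ⊔ F ∙ x),
    h.finrank_sup (by omega), h.finrank_eq]

include hnd hV

theorem extensionGenerators_of_le_of_le (hi : i ≤ k) (hm : m ≤ k) :
    extensionGenerators B x y i m k W =
      (Fintype.card F : ℚ) ^ (2 * n - k) - (Fintype.card F : ℚ) ^ k := by
  rw [h.extensionGenerators_eq, h.setOf_extend_of_le_of_le hB hi hm,
    ncard_submodule_diff h.isotropic,
    LinearMap.BilinForm.finrank_orthogonal hnd, hV, h.finrank_eq]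

theorem extensionGenerators_of_le_of_eq (hi : i ≤ k) (hm : k + 1 = m) :
    extensionGenerators B x y i m k W =
      (Fintype.card F : ℚ) ^ (2 * n - k) - (Fintype.card F : ℚ) ^ (2 * n - (k + 1)) := by
  rw [h.extensionGenerators_eq, h.setOf_extend_of_le_of_eq hB hi hm,
    ncard_submodule_diff (LinearMap.BilinForm.orthogonal_le le_sup_left),
    LinearMap.BilinForm.finrank_orthogonal hnd, LinearMap.BilinForm.finrank_orthogonal hnd, hV,
    h.finrank_eq, h.finrank_sup_right]

theorem extensionGenerators_of_le_of_lt (hi : i ≤ k) (hm : k + 1 < m) :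
    extensionGenerators B x y i m k W =
      (Fintype.card F : ℚ) ^ (2 * n - (k + 1)) - (Fintype.card F : ℚ) ^ (k + 1) := by
  rw [h.extensionGenerators_eq, h.setOf_extend_of_le_of_lt hB hi hm,
    ncard_submodule_diff
      (isotropic_sup_span hB h.isotropic (h.mem_orthogonal_iff.2 (by omega))),
    LinearMap.BilinForm.finrank_orthogonal hnd, hV, h.finrank_sup_right]

theorem extensionGenerators_of_lt_of_le (hi : k + 1 < i) (hm : m ≤ k) :
    extensionGenerators B x y i m k W =
      (Fintype.card F : ℚ) ^ (2 * n - (k + 1)) - (Fintype.card F : ℚ) ^ (k + 1) := by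
  rw [h.extensionGenerators_eq, h.setOf_extend_of_lt_of_le hB hi hm,
    ncard_submodule_diff (h.isotropic_sup hB),
    LinearMap.BilinForm.finrank_orthogonal hnd, hV, h.finrank_sup (by omega)]

theorem extensionGenerators_of_lt_of_eq (hxy : B x y = 0) (hi : k + 1 < i) (hm : k + 1 = m) :
    extensionGenerators B x y i m k W = (Fintype.card F : ℚ) ^ (2 * n - (k + 1)) -
      (Fintype.card F : ℚ) ^ (2 * n - (k + 2)) := by
  have hy : y ∈ B.orthogonal (W ⊔ F ∙ x) :=
    mem_orthogonal_sup_span.2 ⟨h.mem_orthogonal_iff.2 (by omega), hxy⟩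
  have hsub : W ⊔ F ∙ x ≤ B.orthogonal (W ⊔ F ∙ x ⊔ F ∙ y) :=
    le_sup_left.trans (isotropic_sup_span hB (h.isotropic_sup hB) hy)
  rw [h.extensionGenerators_eq, h.setOf_extend_of_lt_of_eq hB hi hm, sdiff_sdiff_left,
    sup_eq_left.2 (show ((W ⊔ F ∙ x : Submodule F V) : Set V) ≤ _ from hsub),
    ncard_submodule_diff (LinearMap.BilinForm.orthogonal_le le_sup_left),
    LinearMap.BilinForm.finrank_orthogonal hnd, LinearMap.BilinForm.finrank_orthogonal hnd, hV,
    h.finrank_sup (by omega), h.finrank_sup_sup (by omega)]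

theorem extensionGenerators_of_lt_of_eq_of_ne (hxy : B x y ≠ 0) (hi : k + 1 < i) (hm : k + 1 = m) :
    extensionGenerators B x y i m k W = (Fintype.card F : ℚ) ^ (2 * n - (k + 1)) -
      (Fintype.card F : ℚ) ^ (2 * n - (k + 2)) -
      ((Fintype.card F : ℚ) ^ (k + 1) - (Fintype.card F : ℚ) ^ k) := by
  have : Finite V := Module.finite_of_finite F
  have hy := h.mem_orthogonal_iff.2 (by omega)
  have hsub : ((W ⊔ F ∙ x : Submodule F V) : Set V) \ W ⊆
      (B.orthogonal (W ⊔ F ∙ x) : Set V) \ B.orthogonal (W ⊔ F ∙ x ⊔ F ∙ y) := by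
    rintro u ⟨h1, h2⟩
    refine ⟨h.isotropic_sup hB h1, fun h3 => ?_⟩
    have h4 : y ∈ B.orthogonal (W ⊔ F ∙ u) :=
      mem_orthogonal_sup_span.2 ⟨hy, hB.isRefl _ _ (mem_orthogonal_sup_span.1 h3).2⟩
    exact hxy (h4 x (mem_sup_span_exchange h1 h2))
  have hset : ((B.orthogonal (W ⊔ F ∙ x) : Set V) \ B.orthogonal (W ⊔ F ∙ x ⊔ F ∙ y)) \
        (W ⊔ F ∙ x : Submodule F V) =
      ((B.orthogonal (W ⊔ F ∙ x) : Set V) \ B.orthogonal (W ⊔ F ∙ x ⊔ F ∙ y)) \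
        (((W ⊔ F ∙ x : Submodule F V) : Set V) \ W) := by
    ext u
    simp only [Set.mem_sdiff, SetLike.mem_coe, not_and, not_not]
    refine and_congr_right fun h1 => ⟨fun h2 h3 => absurd h3 h2, fun h2 h3 => h1.2 ?_⟩
    exact mem_orthogonal_sup_span.2 ⟨h1.1, hB.isRefl _ _ (hy u (h2 h3))⟩
  rw [h.extensionGenerators_eq, h.setOf_extend_of_lt_of_eq hB hi hm, hset, Set.ncard_sdiff hsub,
    Nat.cast_sub (Set.ncard_le_ncard hsub), ncard_submodule_diff (le_sup_left : W ≤ W ⊔ F ∙ x),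
    ncard_submodule_diff (LinearMap.BilinForm.orthogonal_le le_sup_left),
    LinearMap.BilinForm.finrank_orthogonal hnd, LinearMap.BilinForm.finrank_orthogonal hnd, hV,
    h.finrank_sup (by omega), h.finrank_sup_sup (by omega), h.finrank_eq]

theorem extensionGenerators_of_lt_of_lt (hxy : B x y = 0) (hi : k + 1 < i) (hm : k + 1 < m) :
    extensionGenerators B x y i m k W =
      (Fintype.card F : ℚ) ^ (2 * n - (k + 2)) - (Fintype.card F : ℚ) ^ (k + 2) := by
  have hy : y ∈ B.orthogonal (W ⊔ F ∙ x) :=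
    mem_orthogonal_sup_span.2 ⟨h.mem_orthogonal_iff.2 (by omega), hxy⟩
  rw [h.extensionGenerators_eq, h.setOf_extend_of_lt_of_lt hB hi hm,
    ncard_submodule_diff (isotropic_sup_span hB (h.isotropic_sup hB) hy),
    LinearMap.BilinForm.finrank_orthogonal hnd, hV, h.finrank_sup_sup (by omega)]

theorem extensionGenerators_of_lt_of_lt_of_ne (hxy : B x y ≠ 0) (hi : k + 1 < i) (hm : k + 1 < m) :
    extensionGenerators B x y i m k W =
      (Fintype.card F : ℚ) ^ (2 * n - (k + 2)) - (Fintype.card F : ℚ) ^ k := by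
  have hy := h.mem_orthogonal_iff.2 (by omega)
  have hW : W ≤ B.orthogonal (W ⊔ F ∙ x ⊔ F ∙ y) := fun w hw => by
    rw [mem_orthogonal_sup_span, mem_orthogonal_sup_span]
    exact ⟨⟨h.isotropic hw, hB.isRefl _ _ (h.mem_orthogonal w hw)⟩, hB.isRefl _ _ (hy w hw)⟩
  have hset : (B.orthogonal (W ⊔ F ∙ x ⊔ F ∙ y) : Set V) \ (W ⊔ F ∙ x ⊔ F ∙ y : Submodule F V) =
      (B.orthogonal (W ⊔ F ∙ x ⊔ F ∙ y) : Set V) \ W := by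
    ext u
    simp only [Set.mem_sdiff, SetLike.mem_coe]
    refine and_congr_right fun h1 => not_congr ⟨fun h2 => ?_, fun h2 =>
      Submodule.mem_sup_left (Submodule.mem_sup_left h2)⟩
    rw [mem_orthogonal_sup_span, mem_orthogonal_sup_span] at h1
    by_contra hu
    by_cases h3 : u ∈ W ⊔ F ∙ x
    · have h4 : y ∈ B.orthogonal (W ⊔ F ∙ u) :=
        mem_orthogonal_sup_span.2 ⟨hy, hB.isRefl _ _ h1.2⟩
      exact hxy (h4 x (mem_sup_span_exchange h3 hu))
    · have h4 : x ∈ B.orthogonal (W ⊔ F ∙ x ⊔ F ∙ u) := by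
        rw [mem_orthogonal_sup_span, mem_orthogonal_sup_span]
        exact ⟨⟨h.mem_orthogonal, hB x⟩, hB.isRefl _ _ h1.1.2⟩
      exact hxy (hB.isRefl _ _ (h4 y (mem_sup_span_exchange h2 h3)))
  rw [h.extensionGenerators_eq, h.setOf_extend_of_lt_of_lt hB hi hm, hset, ncard_submodule_diff hW,
    LinearMap.BilinForm.finrank_orthogonal hnd, hV, h.finrank_sup_sup (by omega), h.finrank_eq]

end IsLevel

theorem cB_succ {q : ℚ} (hq : q ≠ 1) (s : ℕ) :
    (q - 1) * cB q (s + 1) = (q ^ (2 * s + 2) - 1) * cB q s := by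
  have : q - 1 ≠ 0 := sub_ne_zero.2 hq
  rw [cB, cB, Finset.prod_Icc_succ_top (by omega)]
  field_simp
  ring_nf

/-- The recursion for `cB` in the form in which it occurs when counting extensions of levels. -/
theorem pow_sub_pow_mul_cB {q : ℚ} (hq : q ≠ 1) {N M k a s t : ℕ} (hN : N = M + (2 * s + 2))
    (hM : M = k + a) (ht : t = s + 1) :
    (q ^ N - q ^ M) * cB q s = (q ^ (k + 1) - q ^ k) * (cB q t * q ^ a) := by
  subst hN hM ht
  linear_combination -q ^ (k + a) * cB_succ hq s

theorem isLevel_zero_iff (hx : x ≠ 0) (hy : y ∉ F ∙ x) (hi : 1 ≤ i) (hm : 1 ≤ m) :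
    IsLevel B x y i m 0 W ↔ W = ⊥ := by
  refine ⟨fun h => Submodule.finrank_eq_zero.1 h.finrank_eq, ?_⟩
  rintro rfl
  refine ⟨finrank_bot F V, bot_le, by simp, ?_, ?_, by simpa using hy⟩
  · exact iff_of_false (by simpa using hx) (by omega)
  · exact iff_of_true (by simp) (by omega)

variable [Fintype F]

theorem one_lt_card_rat : (1 : ℚ) < Fintype.card F := by
  exact_mod_cast Fintype.one_lt_card

/-- A weight function compatible with the numbers of extensions of levels counts the chains. -/
theorem card_isLevel_chain (hx : x ≠ 0) (hy : y ∉ F ∙ x) (hi : 1 ≤ i) (hm : 1 ≤ m) (G : ℕ → ℚ)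
    (hn : G n = 1) (hstep : ∀ k < n, ∀ W, IsLevel B x y i m k W →
      extensionGenerators B x y i m k W * G (k + 1) =
        ((Fintype.card F : ℚ) ^ (k + 1) - (Fintype.card F : ℚ) ^ k) * G k) :
    (Nat.card (LevelChain (IsLevel B x y i m) (· ≤ ·) n) : ℚ) = G 0 := by
  have : Finite V := Module.finite_of_finite F
  have : Finite (Submodule F V) := Finite.of_injective _ SetLike.coe_injective
  rw [← card_levelChain (IsLevel B x y i m) (· ≤ ·) G ⊥
    (fun _ => isLevel_zero_iff hx hy hi hm) n fun k hk W h => ?_, hn, mul_one]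
  have hpos : (0 : ℚ) < (Fintype.card F : ℚ) ^ (k + 1) - (Fintype.card F : ℚ) ^ k :=
    sub_pos.2 (pow_lt_pow_right₀ one_lt_card_rat k.lt_succ_self)
  refine mul_left_cancel₀ hpos.ne' ?_
  rw [← hstep k hk W h, extensionGenerators]
  ring

section Weights

variable (hx : x ≠ 0) (hy : y ∉ F ∙ x) (hi : 1 ≤ i) (hm : 1 ≤ m) (hin : i ≤ n) (hmn : m ≤ n)
include hB hnd hV hx hy hi hm hin hmn

theorem card_chain_of_apply_eq_zero_of_lt (hxy : B x y = 0) (him : i < m) :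
    (Nat.card (LevelChain (IsLevel B x y i m) (· ≤ ·) n) : ℚ) =
      cB (Fintype.card F) (n - 2) * (Fintype.card F : ℚ) ^ (2 * n + i - m - 2) := by
  have hq : (Fintype.card F : ℚ) ≠ 1 := one_lt_card_rat.ne'
  rw [card_isLevel_chain hx hy hi hm (fun k =>
    if i ≤ k then
      if m ≤ k then cB (Fintype.card F) (n - k)
      else cB (Fintype.card F) (n - k - 1) * (Fintype.card F : ℚ) ^ (2 * n - m - k)
    else cB (Fintype.card F) (n - k - 2) *
      (Fintype.card F : ℚ) ^ (2 * n + i - m - 2 - 2 * k))]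
  · simp only [show ¬ i ≤ 0 by omega, if_false, Nat.sub_zero, mul_zero]
  · simp [hin, hmn, cB]
  intro k hk W h
  rcases le_or_gt i k with hik | hik
  · rcases lt_trichotomy (k + 1) m with hmk | hmk | hmk
    · rw [h.extensionGenerators_of_le_of_lt hB hnd hV hik hmk]
      simp only [show i ≤ k + 1 by omega, show ¬ m ≤ k + 1 by omega, hik, show ¬ m ≤ k by omega,
        if_true, if_false]
      rw [show 2 * n - m - k = 2 * n - m - (k + 1) + 1 by omega]
      linear_combination (Fintype.card F : ℚ) ^ (2 * n - m - (k + 1)) *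
        pow_sub_pow_mul_cB hq (N := 2 * n - (k + 1)) (M := k + 1) (k := k) (a := 1)
          (s := n - (k + 1) - 1) (t := n - k - 1) (by omega) rfl (by omega)
    · rw [h.extensionGenerators_of_le_of_eq hB hnd hV hik hmk]
      simp only [show i ≤ k + 1 by omega, show m ≤ k + 1 by omega, hik, show ¬ m ≤ k by omega,
        if_true, if_false]
      rw [show 2 * n - k = 2 * n - m - k + k + 1 by omega,
        show 2 * n - (k + 1) = 2 * n - m - k + k by omega, show n - (k + 1) = n - k - 1 by omega]
      ring
    · rw [h.extensionGenerators_of_le_of_le hB hnd hV hik (by omega)]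
      simp only [show i ≤ k + 1 by omega, show m ≤ k + 1 by omega, hik, show m ≤ k by omega,
        if_true]
      linear_combination
        pow_sub_pow_mul_cB hq (N := 2 * n - k) (M := k) (k := k) (a := 0)
          (s := n - (k + 1)) (t := n - k) (by omega) rfl (by omega)
  · rcases (Nat.succ_le_of_lt hik).eq_or_lt with hik' | hik'
    · rw [h.extensionGenerators_of_eq hB hik' (by omega) fun _ => hxy]
      simp only [show i ≤ k + 1 by omega, show ¬ m ≤ k + 1 by omega, show ¬ i ≤ k by omega,
        if_true, if_false]
      rw [show 2 * n + i - m - 2 - 2 * k = 2 * n - m - (k + 1) by omega,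
        show n - (k + 1) - 1 = n - k - 2 by omega]
    · rw [h.extensionGenerators_of_lt_of_lt hB hnd hV hxy hik' (by omega)]
      simp only [show ¬ i ≤ k + 1 by omega, show ¬ i ≤ k by omega, if_false]
      rw [show 2 * n + i - m - 2 - 2 * k = 2 * n + i - m - 2 - 2 * (k + 1) + 2 by omega]
      linear_combination (Fintype.card F : ℚ) ^ (2 * n + i - m - 2 - 2 * (k + 1)) *
        pow_sub_pow_mul_cB hq (N := 2 * n - (k + 2)) (M := k + 2) (k := k) (a := 2)
          (s := n - (k + 1) - 2) (t := n - k - 2) (by omega) rfl (by omega)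

theorem card_chain_of_apply_eq_zero_of_gt (hxy : B x y = 0) (hmi : m < i) :
    (Nat.card (LevelChain (IsLevel B x y i m) (· ≤ ·) n) : ℚ) =
      cB (Fintype.card F) (n - 2) * (Fintype.card F : ℚ) ^ (2 * n + i - m - 3) := by
  have hq : (Fintype.card F : ℚ) ≠ 1 := one_lt_card_rat.ne'
  rw [card_isLevel_chain hx hy hi hm (fun k =>
    if i ≤ k then cB (Fintype.card F) (n - k)
    else if m ≤ k then cB (Fintype.card F) (n - k - 1) * (Fintype.card F : ℚ) ^ (i - 1 - k)
    else cB (Fintype.card F) (n - k - 2) *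
      (Fintype.card F : ℚ) ^ (2 * n + i - m - 3 - 2 * k))]
  · simp only [show ¬ i ≤ 0 by omega, show ¬ m ≤ 0 by omega, if_false, Nat.sub_zero, mul_zero]
  · simp [hin, cB]
  intro k hk W h
  rcases le_or_gt i k with hik | hik
  · rw [h.extensionGenerators_of_le_of_le hB hnd hV hik (by omega)]
    simp only [show i ≤ k + 1 by omega, hik, if_true]
    linear_combination
      pow_sub_pow_mul_cB hq (N := 2 * n - k) (M := k) (k := k) (a := 0)
        (s := n - (k + 1)) (t := n - k) (by omega) rfl (by omega)
  rcases (Nat.succ_le_of_lt hik).eq_or_lt with hik' | hik'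
  · rw [h.extensionGenerators_of_eq hB hik' (by omega) (by omega)]
    simp only [show i ≤ k + 1 by omega, show ¬ i ≤ k by omega, show m ≤ k by omega,
      if_true, if_false]
    rw [show i - 1 - k = 0 by omega, show n - (k + 1) = n - k - 1 by omega]
    ring
  rcases lt_trichotomy (k + 1) m with hmk | hmk | hmk
  · rw [h.extensionGenerators_of_lt_of_lt hB hnd hV hxy hik' hmk]
    simp only [show ¬ i ≤ k + 1 by omega, show ¬ m ≤ k + 1 by omega, show ¬ i ≤ k by omega,
      show ¬ m ≤ k by omega, if_false]
    rw [show 2 * n + i - m - 3 - 2 * k = 2 * n + i - m - 3 - 2 * (k + 1) + 2 by omega]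
    linear_combination (Fintype.card F : ℚ) ^ (2 * n + i - m - 3 - 2 * (k + 1)) *
      pow_sub_pow_mul_cB hq (N := 2 * n - (k + 2)) (M := k + 2) (k := k) (a := 2)
        (s := n - (k + 1) - 2) (t := n - k - 2) (by omega) rfl (by omega)
  · rw [h.extensionGenerators_of_lt_of_eq hB hnd hV hxy hik' hmk]
    simp only [show ¬ i ≤ k + 1 by omega, show m ≤ k + 1 by omega, show ¬ i ≤ k by omega,
      show ¬ m ≤ k by omega, if_true, if_false]
    obtain ⟨s, rfl⟩ := Nat.exists_eq_add_of_le (show k + 2 ≤ n by omega)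
    rw [show 2 * (k + 2 + s) + i - m - 3 - 2 * k = 2 * s + 2 + (i - 1 - (k + 1)) by omega,
      show 2 * (k + 2 + s) - (k + 1) = k + 2 * s + 3 by omega,
      show 2 * (k + 2 + s) - (k + 2) = k + 2 * s + 2 by omega,
      show k + 2 + s - (k + 1) - 1 = k + 2 + s - k - 2 by omega]
    ring
  · rw [h.extensionGenerators_of_lt_of_le hB hnd hV hik' (by omega)]
    simp only [show ¬ i ≤ k + 1 by omega, show m ≤ k + 1 by omega, show ¬ i ≤ k by omega,
      show m ≤ k by omega, if_true, if_false]
    rw [show i - 1 - k = i - 1 - (k + 1) + 1 by omega]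
    linear_combination (Fintype.card F : ℚ) ^ (i - 1 - (k + 1)) *
      pow_sub_pow_mul_cB hq (N := 2 * n - (k + 1)) (M := k + 1) (k := k) (a := 1)
        (s := n - (k + 1) - 1) (t := n - k - 1) (by omega) rfl (by omega)

omit hmn in
theorem card_chain_of_apply_ne_zero_of_eq (hxy : B x y ≠ 0) (him : i = m) :
    (Nat.card (LevelChain (IsLevel B x y i m) (· ≤ ·) n) : ℚ) =
      cB (Fintype.card F) (n - 1) := by
  have hq : (Fintype.card F : ℚ) ≠ 1 := one_lt_card_rat.ne'
  rw [card_isLevel_chain hx hy hi hm (fun k =>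
    if i ≤ k then cB (Fintype.card F) (n - k) else cB (Fintype.card F) (n - k - 1))]
  · simp only [show ¬ i ≤ 0 by omega, if_false, Nat.sub_zero]
  · simp [hin, cB]
  intro k hk W h
  rcases le_or_gt i k with hik | hik
  · rw [h.extensionGenerators_of_le_of_le hB hnd hV hik (by omega)]
    simp only [show i ≤ k + 1 by omega, hik, if_true]
    linear_combination
      pow_sub_pow_mul_cB hq (N := 2 * n - k) (M := k) (k := k) (a := 0)
        (s := n - (k + 1)) (t := n - k) (by omega) rfl (by omega)
  rcases (Nat.succ_le_of_lt hik).eq_or_lt with hik' | hik'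
  · rw [h.extensionGenerators_of_eq hB hik' (fun _ => hxy) (by omega)]
    simp only [show i ≤ k + 1 by omega, show ¬ i ≤ k by omega, if_true, if_false]
    rw [show n - (k + 1) = n - k - 1 by omega]
  · rw [h.extensionGenerators_of_lt_of_lt_of_ne hB hnd hV hxy hik' (by omega)]
    simp only [show ¬ i ≤ k + 1 by omega, show ¬ i ≤ k by omega, if_false]
    linear_combination
      pow_sub_pow_mul_cB hq (N := 2 * n - (k + 2)) (M := k) (k := k) (a := 0)
        (s := n - (k + 1) - 1) (t := n - k - 1) (by omega) rfl (by omega)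

theorem card_chain_of_apply_ne_zero_of_gt (hxy : B x y ≠ 0) (hmi : m < i) :
    (Nat.card (LevelChain (IsLevel B x y i m) (· ≤ ·) n) : ℚ) =
      cB (Fintype.card F) (n - 1) * ((Fintype.card F : ℚ) - 1) *
        (Fintype.card F : ℚ) ^ (i - m - 1) := by
  have hq : (Fintype.card F : ℚ) ≠ 1 := one_lt_card_rat.ne'
  rw [card_isLevel_chain hx hy hi hm (fun k =>
    if i ≤ k then cB (Fintype.card F) (n - k)
    else if m ≤ k then cB (Fintype.card F) (n - k - 1) * (Fintype.card F : ℚ) ^ (i - 1 - k)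
    else cB (Fintype.card F) (n - k - 1) * ((Fintype.card F : ℚ) - 1) *
        (Fintype.card F : ℚ) ^ (i - m - 1))]
  · simp only [show ¬ i ≤ 0 by omega, show ¬ m ≤ 0 by omega, if_false, Nat.sub_zero]
  · simp [hin, cB]
  intro k hk W h
  rcases le_or_gt i k with hik | hik
  · rw [h.extensionGenerators_of_le_of_le hB hnd hV hik (by omega)]
    simp only [show i ≤ k + 1 by omega, hik, if_true]
    linear_combination
      pow_sub_pow_mul_cB hq (N := 2 * n - k) (M := k) (k := k) (a := 0)
        (s := n - (k + 1)) (t := n - k) (by omega) rfl (by omega)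
  rcases (Nat.succ_le_of_lt hik).eq_or_lt with hik' | hik'
  · rw [h.extensionGenerators_of_eq hB hik' (by omega) (by omega)]
    simp only [show i ≤ k + 1 by omega, show ¬ i ≤ k by omega, show m ≤ k by omega,
      if_true, if_false]
    rw [show i - 1 - k = 0 by omega, show n - (k + 1) = n - k - 1 by omega]
    ring
  rcases lt_trichotomy (k + 1) m with hmk | hmk | hmk
  · rw [h.extensionGenerators_of_lt_of_lt_of_ne hB hnd hV hxy hik' hmk]
    simp only [show ¬ i ≤ k + 1 by omega, show ¬ m ≤ k + 1 by omega, show ¬ i ≤ k by omega,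
      show ¬ m ≤ k by omega, if_false]
    linear_combination ((Fintype.card F : ℚ) - 1) * (Fintype.card F : ℚ) ^ (i - m - 1) *
      pow_sub_pow_mul_cB hq (N := 2 * n - (k + 2)) (M := k) (k := k) (a := 0)
        (s := n - (k + 1) - 1) (t := n - k - 1) (by omega) rfl (by omega)
  · rw [h.extensionGenerators_of_lt_of_eq_of_ne hB hnd hV hxy hik' hmk]
    simp only [show ¬ i ≤ k + 1 by omega, show m ≤ k + 1 by omega, show ¬ i ≤ k by omega,
      show ¬ m ≤ k by omega, if_true, if_false]
    obtain ⟨s, rfl⟩ := Nat.exists_eq_add_of_le (show k + 2 ≤ n by omega)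
    rw [show i - m - 1 = i - 1 - (k + 1) by omega,
      show 2 * (k + 2 + s) - (k + 1) = k + 2 * s + 3 by omega,
      show 2 * (k + 2 + s) - (k + 2) = k + 2 * s + 2 by omega,
      show k + 2 + s - (k + 1) - 1 = s by omega, show k + 2 + s - k - 1 = s + 1 by omega]
    linear_combination -(Fintype.card F : ℚ) ^ (i - 1 - (k + 1)) *
      ((Fintype.card F : ℚ) ^ (k + 1) - (Fintype.card F : ℚ) ^ k) * cB_succ hq s
  · rw [h.extensionGenerators_of_lt_of_le hB hnd hV hik' (by omega)]
    simp only [show ¬ i ≤ k + 1 by omega, show m ≤ k + 1 by omega, show ¬ i ≤ k by omega,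
      show m ≤ k by omega, if_true, if_false]
    rw [show i - 1 - k = i - 1 - (k + 1) + 1 by omega]
    linear_combination (Fintype.card F : ℚ) ^ (i - 1 - (k + 1)) *
      pow_sub_pow_mul_cB hq (N := 2 * n - (k + 1)) (M := k + 1) (k := k) (a := 1)
        (s := n - (k + 1) - 1) (t := n - k - 1) (by omega) rfl (by omega)

end Weights

end Counting

end Symplectic

section Flags

variable {F : Type} [Field F] {n : ℕ} {B : LinearMap.BilinForm F (Fin (2 * n) → F)}

theorem SympFlag.mono (c : SympFlag F n B) {k l : ℕ} (hk : k ≤ n) (hl : l ≤ n) (h : k ≤ l) :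
    c.1 ⟨k, by omega⟩ ≤ c.1 ⟨l, by omega⟩ :=
  c.2.1 (Fin.mk_le_mk.2 h)

theorem SympFlag.isotropic_last (c : SympFlag F n B) :
    c.1 (Fin.last n) ≤ B.orthogonal (c.1 (Fin.last n)) :=
  fun x hx y hy => c.2.2.2 y hy x hx

theorem sympMem_of_le (c : SympFlag F n B) {k : ℕ} (h : k ≤ n) :
    sympMem c k = c.1 ⟨k, by omega⟩ := by
  simp [sympMem, h]

theorem sympMem_of_ge (hB : B.Nondegenerate) (c : SympFlag F n B) {k : ℕ}
    (h : n ≤ k) : sympMem c k = B.orthogonal (c.1 ⟨2 * n - k, by omega⟩) := by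
  rcases h.eq_or_lt with rfl | h
  · rw [sympMem_of_le c le_rfl]
    have h2 : (⟨2 * n - n, by omega⟩ : Fin (n + 1)) = Fin.last n := Fin.ext (by simp; omega)
    have h3 : (⟨n, by omega⟩ : Fin (n + 1)) = Fin.last n := rfl
    rw [h2, h3]
    refine Submodule.eq_of_le_of_finrank_eq c.isotropic_last ?_
    rw [LinearMap.BilinForm.finrank_orthogonal hB, Module.finrank_fin_fun, c.2.2.1, Fin.val_last]
    omega
  · by_cases h2 : k ≤ 2 * n - 1
    · simp [sympMem, h2, Nat.not_le.2 h]
    · have h0 : c.1 ⟨2 * n - k, by omega⟩ = ⊥ := by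
        refine Submodule.finrank_eq_zero.1 ?_
        rw [c.2.2.1]
        simp only
        omega
      rw [h0, LinearMap.BilinForm.orthogonal_bot]
      simp [sympMem, h2, Nat.not_le.2 h]

theorem sympMem_monotone (hB : B.Nondegenerate) (c : SympFlag F n B) : Monotone (sympMem c) := by
  refine monotone_nat_of_le_succ fun k => ?_
  rcases Nat.lt_or_ge k n with h | h
  · rw [sympMem_of_le c h.le, sympMem_of_le c h]
    exact c.mono h.le h (by omega)
  · rw [sympMem_of_ge hB c h, sympMem_of_ge hB c (by omega)]
    exact LinearMap.BilinForm.orthogonal_le (c.mono (by omega) (by omega) (by omega))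

theorem sympType_eq_iff (hB : B.Nondegenerate) (c : SympFlag F n B) (x : Fin (2 * n) → F)
    {i : ℕ} (hi : 1 ≤ i) :
    sympType c (F ∙ x) = i ↔ x ∈ sympMem c i ∧ x ∉ sympMem c (i - 1) := by
  obtain ⟨i, rfl⟩ := Nat.exists_eq_add_of_le' hi
  have hup : IsUpperSet {k | (F ∙ x) ≤ sympMem c k} :=
    fun k l hkl hk => le_trans hk (sympMem_monotone hB c hkl)
  rw [sympType, Nat.sInf_upward_closed_eq_succ_iff hup]
  simp [Submodule.span_singleton_le_iff_mem]

theorem sympType_eq_iff_mem (hB : B.Nondegenerate) (c : SympFlag F n B) (x : Fin (2 * n) → F)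
    {i : ℕ} (hi : 1 ≤ i) (hin : i ≤ n) :
    sympType c (F ∙ x) = i ↔ ∀ k : Fin (n + 1), x ∈ c.1 k ↔ i ≤ k := by
  rw [sympType_eq_iff hB c x hi, sympMem_of_le c hin, sympMem_of_le c (by omega)]
  constructor
  · rintro ⟨h1, h2⟩ k
    refine ⟨fun h => ?_, fun h => c.2.1 (Fin.mk_le_of_le_val h) h1⟩
    by_contra hk
    exact h2 (c.mono (by omega) (by omega) (show (k : ℕ) ≤ i - 1 by omega) h)
  · intro h
    rw [h, h]
    simp only
    omega

theorem sympType_eq_iff_mem_orthogonal (hB : B.Nondegenerate) (c : SympFlag F n B)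
    (y : Fin (2 * n) → F) {j : ℕ} (hj : n + 1 ≤ j) (hjn : j ≤ 2 * n) :
    sympType c (F ∙ y) = j ↔
      ∀ k : Fin (n + 1), y ∈ B.orthogonal (c.1 k) ↔ (k : ℕ) < 2 * n + 1 - j := by
  rw [sympType_eq_iff hB c y (by omega), sympMem_of_ge hB c (by omega),
    sympMem_of_ge hB c (by omega)]
  constructor
  · rintro ⟨h1, h2⟩ k
    refine ⟨fun h => ?_, fun h => LinearMap.BilinForm.orthogonal_le
      (c.mono (by omega) (by omega) (show (k : ℕ) ≤ 2 * n - j by omega)) h1⟩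
    by_contra hk
    exact h2 (LinearMap.BilinForm.orthogonal_le
      (c.mono (by omega) (by omega) (show 2 * n - (j - 1) ≤ (k : ℕ) by omega)) h)
  · intro h
    rw [h, h]
    simp only
    omega

/-- Maximal isotropic flags of given types with respect to two points are the chains of levels. -/
def sympFlagEquivLevelChain (hB : B.Nondegenerate) (x y : Fin (2 * n) → F) {i j : ℕ}
    (hi : 1 ≤ i) (hin : i ≤ n) (hj : n + 1 ≤ j) (hjn : j ≤ 2 * n) :
    {c : SympFlag F n B // sympType c (F ∙ x) = i ∧ sympType c (F ∙ y) = j} ≃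
      LevelChain (IsLevel B x y i (2 * n + 1 - j)) (· ≤ ·) n where
  toFun c := ⟨c.1.1, by
    obtain ⟨c, hcx, hcy⟩ := c
    rw [sympType_eq_iff_mem hB c x hi hin] at hcx
    rw [sympType_eq_iff_mem_orthogonal hB c y hj hjn] at hcy
    have hx : x ∈ c.1 (Fin.last n) := (hcx _).2 hin
    have hle (k : Fin (n + 1)) : c.1 k ≤ c.1 (Fin.last n) := c.2.1 (Fin.le_last k)
    have horth (k : Fin (n + 1)) : c.1 (Fin.last n) ≤ B.orthogonal (c.1 k) :=
      c.isotropic_last.trans (LinearMap.BilinForm.orthogonal_le (hle k))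
    refine ⟨fun k => ⟨c.2.2.1 k, (hle k).trans (horth k), horth k hx, hcx k, hcy k, fun h => ?_⟩,
      fun k => c.2.1 k.castSucc_le_succ⟩
    have hy := c.isotropic_last (sup_le (hle k) (by simpa using hx) h)
    have := (hcy (Fin.last n)).1 hy
    rw [Fin.val_last] at this
    omega⟩
  invFun U := ⟨⟨U.1, Fin.monotone_iff_le_succ.2 U.2.2, fun k => (U.2.1 k).finrank_eq,
      fun v hv w hw => (U.2.1 (Fin.last n)).isotropic hw v hv⟩,
    (sympType_eq_iff_mem hB _ x hi hin).2 fun k => (U.2.1 k).mem_iff,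
    (sympType_eq_iff_mem_orthogonal hB _ y hj hjn).2 fun k => (U.2.1 k).mem_orthogonal_iff⟩
  left_inv _ := rfl
  right_inv _ := rfl

end Flags

/-- If `x` and `y` are orthogonal, the flag cannot reach `x` in the same step in which it ceases to
be orthogonal to `y`. -/
theorem isEmpty_levelChain_of_eq {F V : Type*} [Field F] [AddCommGroup V] [Module F V]
    [Module.Finite F V] {B : LinearMap.BilinForm F V} {x y : V} {i n : ℕ} (hi : 1 ≤ i)
    (hin : i ≤ n) (hxy : B x y = 0) : IsEmpty (LevelChain (IsLevel B x y i i) (· ≤ ·) n) := by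
  refine ⟨fun U => ?_⟩
  obtain ⟨i, rfl⟩ := Nat.exists_eq_add_of_le' hi
  set k : Fin n := ⟨i, hin⟩
  have h1 := U.2.1 k.castSucc
  have h2 := U.2.1 k.succ
  simp only [Fin.val_castSucc, Fin.val_succ, k] at h1 h2
  have h3 := sup_span_eq_of_finrank (U.2.2 k) (by rw [h1.finrank_eq, h2.finrank_eq])
    (h2.mem_iff.2 le_rfl) (h1.notMem_of_lt i.lt_succ_self)
  have h4 := mem_orthogonal_sup_span.2 ⟨h1.mem_orthogonal_iff.2 i.lt_succ_self, hxy⟩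
  exact lt_irrefl _ (h2.mem_orthogonal_iff.1 (h3 ▸ h4))

/-- The flag cannot contain `x` while it is orthogonal to `y` unless `x` and `y` are orthogonal. -/
theorem isEmpty_levelChain_of_lt {F V : Type*} [Field F] [AddCommGroup V] [Module F V]
    {B : LinearMap.BilinForm F V} {x y : V} {i m n : ℕ} (him : i < m) (hin : i ≤ n)
    (hxy : B x y ≠ 0) : IsEmpty (LevelChain (IsLevel B x y i m) (· ≤ ·) n) := by
  refine ⟨fun U => hxy ?_⟩
  have h := U.2.1 ⟨i, by omega⟩
  exact h.mem_orthogonal_iff.2 him x (h.mem_iff.2 le_rfl)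

theorem exists_eq_span_of_finrank_eq_one {F V : Type*} [Field F] [AddCommGroup V] [Module F V]
    [Module.Finite F V] {X : Submodule F V} (hX : Module.finrank F X = 1) :
    ∃ x, x ≠ 0 ∧ X = F ∙ x := by
  obtain ⟨x, hxX, hx⟩ := X.exists_mem_ne_zero_of_ne_bot fun h => by
    rw [h, finrank_bot] at hX
    exact zero_ne_one hX
  refine ⟨x, hx, (Submodule.eq_of_le_of_finrank_eq (by simpa using hxX) ?_).symm⟩
  rw [finrank_span_singleton hx, hX]

theorem span_singleton_le_orthogonal_span_singleton {F V : Type*} [Field F] [AddCommGroup V]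
    [Module F V] {B : LinearMap.BilinForm F V} {x y : V} :
    F ∙ x ≤ B.orthogonal (F ∙ y) ↔ B y x = 0 := by
  rw [Submodule.span_singleton_le_iff_mem, ← bot_sup_eq (F ∙ y), mem_orthogonal_sup_span]
  simp

/-- For `i ∈ {1,…,n}` and `j ∈ {n+1,…,2n}`, the value of `|C_i^X ∩ C_j^Y|` in all cases:
`0` if `X = Y`; for `X ≠ Y` collinear: `c(n-2,1)·q^(i+j-3)` if `i+j < 2n+1`, `0` if
`i+j = 2n+1`, and `c(n-2,1)·q^(i+j-4)` if `i+j > 2n+1`; for `X, Y` opposite: `0` if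
`i+j < 2n+1`, `c(n-1,1)` if `i+j = 2n+1`, and `c(n-1,1)·(q-1)·q^(i+j-2n-2)` if
`i+j > 2n+1`. -/
theorem card_symp_inter_large (F : Type) [Field F] [Fintype F] (q : ℕ)
    (hq : Fintype.card F = q) (n : ℕ) (hn : 2 ≤ n)
    (B : LinearMap.BilinForm F (Fin (2 * n) → F))
    (hB : B.Nondegenerate) (hBalt : ∀ v, B v v = 0)
    (X Y : Submodule F (Fin (2 * n) → F))
    (hX : Module.finrank F X = 1) (hY : Module.finrank F Y = 1)
    (i j : ℕ) (hi1 : 1 ≤ i) (hi2 : i ≤ n) (hj1 : n + 1 ≤ j) (hj2 : j ≤ 2 * n) :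
    (X = Y →
      Nat.card {c : SympFlag F n B // sympType c X = i ∧ sympType c Y = j} = 0) ∧
    (X ≠ Y → X ≤ B.orthogonal Y →
      (Nat.card {c : SympFlag F n B // sympType c X = i ∧ sympType c Y = j} : ℚ) =
        if i + j < 2 * n + 1 then cB (q : ℚ) (n - 2) * (q : ℚ) ^ (i + j - 3)
        else if i + j = 2 * n + 1 then 0
        else cB (q : ℚ) (n - 2) * (q : ℚ) ^ (i + j - 4)) ∧
    (¬ X ≤ B.orthogonal Y →
      (Nat.card {c : SympFlag F n B // sympType c X = i ∧ sympType c Y = j} : ℚ) =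
        if i + j < 2 * n + 1 then 0
        else if i + j = 2 * n + 1 then cB (q : ℚ) (n - 1)
        else cB (q : ℚ) (n - 1) * ((q : ℚ) - 1) * (q : ℚ) ^ (i + j - 2 * n - 2)) := by
  subst hq
  obtain ⟨x, hx, rfl⟩ := exists_eq_span_of_finrank_eq_one hX
  obtain ⟨y, hy, rfl⟩ := exists_eq_span_of_finrank_eq_one hY
  have hV : Module.finrank F (Fin (2 * n) → F) = 2 * n := Module.finrank_fin_fun F
  have hBalt : B.IsAlt := hBalt
  rw [span_singleton_le_orthogonal_span_singleton,
    Nat.card_congr (sympFlagEquivLevelChain hB x y hi1 hi2 hj1 hj2)]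
  refine ⟨fun hXY => ?_, fun hXY hyx => ?_, fun hyx => ?_⟩
  · rw [← Nat.card_congr (sympFlagEquivLevelChain hB x y hi1 hi2 hj1 hj2), ← hXY]
    have : IsEmpty {c : SympFlag F n B // sympType c (F ∙ x) = i ∧ sympType c (F ∙ x) = j} :=
      ⟨fun c => by have := c.2.1.symm.trans c.2.2; omega⟩
    exact Nat.card_of_isEmpty
  · have hxy := hBalt.isRefl _ _ hyx
    have hy' : y ∉ F ∙ x := fun h => hXY (Submodule.eq_of_le_of_finrank_eq
      ((Submodule.span_singleton_le_iff_mem _ _).2 h) (by rw [hX, hY])).symm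
    split_ifs with h1 h2
    · rw [card_chain_of_apply_eq_zero_of_lt hBalt hB hV hx hy' hi1 (by omega) hi2 (by omega) hxy
        (by omega)]
      congr 2
      omega
    · obtain rfl : i = 2 * n + 1 - j := by omega
      have := isEmpty_levelChain_of_eq hi1 hi2 hxy
      rw [Nat.card_of_isEmpty, Nat.cast_zero]
    · rw [card_chain_of_apply_eq_zero_of_gt hBalt hB hV hx hy' hi1 (by omega) hi2 (by omega) hxy
        (by omega)]
      congr 2
      omega
  · have hxy : B x y ≠ 0 := fun h => hyx (hBalt.isRefl _ _ h)
    have hy' : y ∉ F ∙ x := fun h => hyx <| by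
      obtain ⟨a, rfl⟩ := Submodule.mem_span_singleton.1 h
      rw [map_smul, LinearMap.smul_apply, hBalt x, smul_zero]
    split_ifs with h1 h2
    · have := isEmpty_levelChain_of_lt (n := n) (show i < 2 * n + 1 - j by omega) hi2 hxy
      rw [Nat.card_of_isEmpty, Nat.cast_zero]
    · rw [card_chain_of_apply_ne_zero_of_eq hBalt hB hV hx hy' hi1 (by omega) hi2 hxy (by omega)]
    · rw [card_chain_of_apply_ne_zero_of_gt hBalt hB hV hx hy' hi1 (by omega) hi2 (by omega) hxy
        (by omega)]
      congr 2
      omega
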